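/- For every η ∈ (0,1) there exists a constant C' > 0 depending only on η such that the following holds: for all positive integers d₁, d₂, all integers 1 ≤ s₁ ≤ d₁ and 1 ≤ s₂ ≤ d₂, and every real μ > 0 with μ² ≥ C'·R(s₁,s₂,d₁,d₂), there exists a test Δ with R(Δ,μ) ≤ η; consequently the minimax separation rate satisfies (μ*)² ≤ C'·R(s₁,s₂,d₁,d₂). -/

import Mathlib

open MeasureTheory ProbabilityTheory

noncomputable def Pmeas (d₁ d₂ : ℕ) (X : Fin d₁ → Fin d₂ → ℝ) :
    Measure (Fin d₁ → Fin d₂ → ℝ) :=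
  Measure.pi fun i => Measure.pi fun j => gaussianReal (X i j) 1

def Theta (d₁ d₂ s₁ s₂ : ℕ) (μ : ℝ) : Set (Fin d₁ → Fin d₂ → ℝ) :=
  {X | ∃ (S₁ : Finset (Fin d₁)) (S₂ : Finset (Fin d₂)),
    S₁.card = s₁ ∧ S₂.card = s₂ ∧
    (∀ i j, i ∈ S₁ → j ∈ S₂ → μ ≤ X i j) ∧
    (∀ i j, ¬(i ∈ S₁ ∧ j ∈ S₂) → X i j = 0)}

noncomputable def risk (d₁ d₂ s₁ s₂ : ℕ) (μ : ℝ)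
    (Δ : (Fin d₁ → Fin d₂ → ℝ) → Bool) : ℝ :=
  (Pmeas d₁ d₂ 0 {y | Δ y = true}).toReal +
    ⨆ X ∈ Theta d₁ d₂ s₁ s₂ μ, (Pmeas d₁ d₂ X {y | Δ y = false}).toReal

noncomputable def muStar (η : ℝ) (d₁ d₂ s₁ s₂ : ℕ) : ℝ :=
  sInf {μ : ℝ | 0 < μ ∧ ∃ Δ : (Fin d₁ → Fin d₂ → ℝ) → Bool,
    Measurable Δ ∧ risk d₁ d₂ s₁ s₂ μ Δ < η}

/-- ψ(s₁,s₂,d₁,d₂) = (1/s₁)·log(1 + (d₂/s₂²)·log(e·C(d₁,s₁))) -/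
noncomputable def psi (s₁ s₂ d₁ d₂ : ℕ) : ℝ :=
  (1 / (s₁ : ℝ)) *
    Real.log (1 + ((d₂ : ℝ) / (s₂ : ℝ) ^ 2) *
      Real.log (Real.exp 1 * (d₁.choose s₁ : ℝ)))

/-- φ(s₁,s₂,d₁,d₂) = (d₁/s₁²)·log(1 + d₂/s₂²) -/
noncomputable def phi (s₁ s₂ d₁ d₂ : ℕ) : ℝ :=
  ((d₁ : ℝ) / (s₁ : ℝ) ^ 2) * Real.log (1 + (d₂ : ℝ) / (s₂ : ℝ) ^ 2)

/-- R(s₁,s₂,d₁,d₂) = min(ψ₁₂ + ψ₂₁, φ₁₂, φ₂₁) -/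
noncomputable def rateR (s₁ s₂ d₁ d₂ : ℕ) : ℝ :=
  min (psi s₁ s₂ d₁ d₂ + psi s₂ s₁ d₂ d₁) (min (phi s₁ s₂ d₁ d₂) (phi s₂ s₁ d₂ d₁))

section

open Finset

/-- The law of a Gaussian vector with independent coordinates, unit variances and mean `v`. -/
noncomputable def gaussianShift {ι : Type*} [Fintype ι] (v : ι → ℝ) : Measure (ι → ℝ) :=
  Measure.pi fun j => gaussianReal (v j) 1

instance {ι : Type*} [Fintype ι] (v : ι → ℝ) : IsProbabilityMeasure (gaussianShift v) := by
  unfold gaussianShift; infer_instance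

instance (d₁ d₂ : ℕ) (X : Fin d₁ → Fin d₂ → ℝ) : IsProbabilityMeasure (Pmeas d₁ d₂ X) := by
  unfold Pmeas; infer_instance

lemma hasSubgaussianMGF_sub_mean_gaussianReal (m : ℝ) (v : NNReal) :
    HasSubgaussianMGF (fun x => x - m) v (gaussianReal m v) := by
  have h : (gaussianReal m v).map (fun x => x - m) = gaussianReal 0 v := by
    rw [gaussianReal_map_sub_const, sub_self]
  constructor
  · intro t
    have := integrable_exp_mul_gaussianReal (μ := m) (v := v) t
    simpa [mul_sub, Real.exp_sub] using this.div_const (Real.exp (t * m))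
  · intro t
    rw [mgf_gaussianReal h]
    simp

lemma gaussianReal_real_le_le {m c : ℝ} (h : c ≤ m) :
    (gaussianReal m 1).real {x | x ≤ c} ≤ Real.exp (-(m - c) ^ 2 / 2) := by
  have := (hasSubgaussianMGF_sub_mean_gaussianReal m 1).neg.measure_ge_le (sub_nonneg.2 h)
  simpa only [Pi.neg_apply, neg_sub, sub_le_sub_iff_left, NNReal.coe_one, mul_one] using this

lemma gaussianReal_real_ge_le {m c : ℝ} (h : m ≤ c) :
    (gaussianReal m 1).real {x | c ≤ x} ≤ Real.exp (-(c - m) ^ 2 / 2) := by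
  have := (hasSubgaussianMGF_sub_mean_gaussianReal m 1).measure_ge_le (sub_nonneg.2 h)
  simpa using this

section Shift

variable {ι : Type*} [Fintype ι]

lemma iIndepFun_coord_gaussianShift (v : ι → ℝ) :
    iIndepFun (fun j (z : ι → ℝ) => z j) (gaussianShift v) :=
  iIndepFun_pi (μ := fun j => gaussianReal (v j) 1) (X := fun _ => id) fun _ => aemeasurable_id

lemma measurePreserving_coord_gaussianShift (v : ι → ℝ) (j : ι) :
    MeasurePreserving (fun z : ι → ℝ => z j) (gaussianShift v) (gaussianReal (v j) 1) :=
  measurePreserving_eval (fun j => gaussianReal (v j) 1) j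

lemma hasSubgaussianMGF_sum_gaussianShift (v : ι → ℝ) (B : Finset ι) :
    HasSubgaussianMGF (fun z : ι → ℝ => ∑ j ∈ B, (z j - v j)) (B.card : NNReal)
      (gaussianShift v) := by
  have hind : iIndepFun (fun j (z : ι → ℝ) => z j - v j) (gaussianShift v) :=
    (iIndepFun_coord_gaussianShift v).comp (fun j x => x - v j) (fun j => by fun_prop)
  have := HasSubgaussianMGF.sum_of_iIndepFun (c := fun _ => 1) (s := B) hind (fun j _ => ?_)
  · simpa using this
  · refine HasSubgaussianMGF.of_map (X := fun x => x - v j) (Y := fun z : ι → ℝ => z j)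
      (measurable_pi_apply j).aemeasurable ?_
    rw [(measurePreserving_coord_gaussianShift v j).map_eq]
    exact hasSubgaussianMGF_sub_mean_gaussianReal _ _

lemma gaussianShift_sum_ge_le (v : ι → ℝ) (B : Finset ι) {t : ℝ} (ht : 0 ≤ t) :
    (gaussianShift v).real {z | ∑ j ∈ B, v j + t ≤ ∑ j ∈ B, z j} ≤
      Real.exp (-t ^ 2 / (2 * B.card)) := by
  have := (hasSubgaussianMGF_sum_gaussianShift v B).measure_ge_le ht
  simpa [sum_sub_distrib, le_sub_iff_add_le, add_comm] using this

lemma gaussianShift_sum_le_le (v : ι → ℝ) (B : Finset ι) {t : ℝ} (ht : 0 ≤ t) :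
    (gaussianShift v).real {z | ∑ j ∈ B, z j ≤ ∑ j ∈ B, v j - t} ≤
      Real.exp (-t ^ 2 / (2 * B.card)) := by
  have := (hasSubgaussianMGF_sum_gaussianShift v B).neg.measure_ge_le ht
  simpa [sum_sub_distrib, le_sub_comm] using this

lemma gaussianShift_map_sum_div_sqrt (v : ι → ℝ) {A : Finset ι} (hA : 0 < A.card) :
    (gaussianShift v).map (fun z => (∑ i ∈ A, z i) / √(A.card : ℝ)) =
      gaussianReal ((∑ i ∈ A, v i) / √(A.card : ℝ)) 1 := by
  have key : ∀ B : Finset ι, (gaussianShift v).map (fun z => ∑ i ∈ B, z i) =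
      gaussianReal (∑ i ∈ B, v i) (B.card : NNReal) := by
    classical
    intro B
    induction B using Finset.induction_on with
    | empty => simp [Measure.map_const, gaussianReal_zero_var]
    | insert a B ha ih =>
      have hind := ((iIndepFun_coord_gaussianShift v).indepFun_finsetSum_of_notMem
        (fun j => measurable_pi_apply j) ha).symm
      have h1 := gaussianReal_add_gaussianReal_of_indepFun hind
        (measurePreserving_coord_gaussianShift v a).map_eq
        (by rw [← ih]; congr 1; ext z; simp)
      rw [sum_insert ha, card_insert_of_notMem ha, Nat.cast_add, add_comm (B.card : NNReal),
        Nat.cast_one, ← h1]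
      congr 1
      ext z
      simp [sum_insert ha]
  have hc : (fun z : ι → ℝ => (∑ i ∈ A, z i) / √(A.card : ℝ)) =
      (fun x => x / √(A.card : ℝ)) ∘ fun z => ∑ i ∈ A, z i := rfl
  rw [hc, ← Measure.map_map (by fun_prop) (by fun_prop), key, gaussianReal_map_div_const]
  congr 1
  have : (A.card : NNReal) ≠ 0 := by positivity
  rw [← NNReal.coe_inj]
  simp [this]

end Shift

lemma Pmeas_map_swap (d₁ d₂ : ℕ) (X : Fin d₁ → Fin d₂ → ℝ) :
    (Pmeas d₁ d₂ X).map (fun Y j i => Y i j) = Pmeas d₂ d₁ (fun j i => X i j) := by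
  symm
  refine Measure.pi_eq_generateFrom
    (C := fun _ => Set.univ.pi '' Set.univ.pi fun _ : Fin d₁ => {s : Set ℝ | MeasurableSet s})
    (fun _ => generateFrom_pi) (fun _ => isPiSystem_pi) (fun j => ?_) ?_
  · exact ⟨fun _ => Set.univ, fun _ => ⟨fun _ => Set.univ, fun _ _ => Set.mem_ofPred_eq.mpr .univ,
      Set.pi_univ _⟩, fun _ => measure_lt_top _ _, Set.iUnion_const _⟩
  · intro s hs
    choose u hu hus using hs
    have hu' : ∀ j i, MeasurableSet (u j i) := fun j i => hu j i (Set.mem_univ i)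
    have hm : Measurable (fun (Y : Fin d₁ → Fin d₂ → ℝ) j i => Y i j) := by fun_prop
    rw [Measure.map_apply hm (.univ_pi fun j => hus j ▸ .univ_pi (hu' j))]
    have hpre : (fun (Y : Fin d₁ → Fin d₂ → ℝ) j i => Y i j) ⁻¹' (Set.univ.pi s) =
        Set.univ.pi fun i => Set.univ.pi fun j => u j i := by
      ext Y
      simp only [← hus, Set.mem_preimage, Set.mem_univ_pi]
      exact forall_comm
    rw [hpre, Pmeas, Measure.pi_pi]
    simp_rw [← hus, Measure.pi_pi]
    exact prod_comm

/-- There is a test of the null hypothesis against the means which are at least `a` on some set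
of `s` coordinates and vanish elsewhere, with type I and type II errors at most `α` and `β`. -/
def HasVectorTest (ι : Type*) [Fintype ι] (s : ℕ) (a α β : ℝ) : Prop :=
  ∃ φ : (ι → ℝ) → Bool, Measurable φ ∧
    (gaussianShift (0 : ι → ℝ)).real {z | φ z = true} ≤ α ∧
    ∀ (v : ι → ℝ) (S : Finset ι), S.card = s → (∀ j ∈ S, a ≤ v j) → (∀ j ∉ S, v j = 0) →
      (gaussianShift v).real {z | φ z = false} ≤ β

lemma measurable_decide_of_measurableSet {α : Type*} [MeasurableSpace α] {p : α → Prop}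
    [DecidablePred p] (hp : MeasurableSet {x | p x}) : Measurable fun x => decide (p x) := by
  refine measurable_to_bool ?_
  convert hp using 1
  ext x
  simp

lemma HasVectorTest.mono {ι : Type*} [Fintype ι] {s : ℕ} {a α β α' β' : ℝ}
    (h : HasVectorTest ι s a α β) (hα : α ≤ α') (hβ : β ≤ β') : HasVectorTest ι s a α' β' := by
  obtain ⟨φ, hm, h0, h1⟩ := h
  exact ⟨φ, hm, h0.trans hα, fun v S a b c => (h1 v S a b c).trans hβ⟩

open Classical in
/-- The scan test: reject when the sum of the coordinates over some member of the family `𝓑` is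
large. -/
lemma hasVectorTest_scan {ι : Type*} [Fintype ι] {s n : ℕ} {a t : ℝ} (𝓑 : Finset (Finset ι))
    (hcard : ∀ B ∈ 𝓑, B.card = n)
    (hcover : ∀ S : Finset ι, S.card = s → ∃ B ∈ 𝓑, S ⊆ B)
    (ht : 0 ≤ t) (hsa : 2 * t ≤ s * a) :
    HasVectorTest ι s a (𝓑.card * Real.exp (-t ^ 2 / (2 * n))) (Real.exp (-t ^ 2 / (2 * n))) := by
  refine ⟨fun z => decide (∃ B ∈ 𝓑, t < ∑ j ∈ B, z j), ?_, ?_, ?_⟩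
  · refine measurable_decide_of_measurableSet ?_
    have : {z : ι → ℝ | ∃ B ∈ 𝓑, t < ∑ j ∈ B, z j} = ⋃ B ∈ 𝓑, {z | t < ∑ j ∈ B, z j} := by
      ext; simp
    rw [this]
    exact Finset.measurableSet_biUnion _ fun B _ =>
      measurableSet_lt measurable_const (by fun_prop)
  · have hsub : {z : ι → ℝ | decide (∃ B ∈ 𝓑, t < ∑ j ∈ B, z j) = true} ⊆
        ⋃ B ∈ 𝓑, {z | t ≤ ∑ j ∈ B, z j} := by
      intro z hz
      simp only [decide_eq_true_eq, Set.mem_ofPred_eq] at hz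
      obtain ⟨B, hB, hz⟩ := hz
      simp only [Set.mem_iUnion]
      exact ⟨B, hB, hz.le⟩
    refine (measureReal_mono hsub (measure_ne_top _ _)).trans
      ((measureReal_biUnion_finset_le _ _).trans ?_)
    rw [← nsmul_eq_mul]
    refine sum_le_card_nsmul _ _ _ fun B hB => ?_
    have := gaussianShift_sum_ge_le (0 : ι → ℝ) B ht
    rw [hcard B hB] at this
    simpa using this
  · intro v S hS hv hv0
    obtain ⟨B, hB, hSB⟩ := hcover S hS
    have hsum : s * a ≤ ∑ j ∈ B, v j := by
      rw [← sum_subset hSB fun j _ hj => hv0 j hj, ← hS, ← nsmul_eq_mul]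
      exact card_nsmul_le_sum _ _ _ hv
    have hsub : {z : ι → ℝ | decide (∃ B ∈ 𝓑, t < ∑ j ∈ B, z j) = false} ⊆
        {z | ∑ j ∈ B, z j ≤ ∑ j ∈ B, v j - t} := by
      intro z hz
      simp only [decide_eq_false_iff_not, Set.mem_ofPred_eq, not_exists, not_and, not_lt] at hz ⊢
      linarith [hz B hB]
    have := gaussianShift_sum_le_le v B ht
    rw [hcard B hB] at this
    exact (measureReal_mono hsub).trans this

/-- The indicator of the half-line `(c, ∞)`. -/
noncomputable def exceed (c x : ℝ) : ℝ := (Set.Ioi c).indicator 1 x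

lemma measurable_exceed (c : ℝ) : Measurable (exceed c) :=
  measurable_one.indicator measurableSet_Ioi

lemma exceed_nonneg (c x : ℝ) : 0 ≤ exceed c x :=
  Set.indicator_nonneg (by simp) x

lemma exceed_le_one (c x : ℝ) : exceed c x ≤ 1 :=
  Set.indicator_le_self' (f := (1 : ℝ → ℝ)) (s := Set.Ioi c) (by simp) x

lemma memLp_exceed (c : ℝ) (μ : Measure ℝ) [IsFiniteMeasure μ] : MemLp (exceed c) 2 μ :=
  .of_bound (measurable_exceed c).aestronglyMeasurable 1 (.of_forall fun x => by
    rw [Real.norm_of_nonneg (exceed_nonneg c x)]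
    exact exceed_le_one c x)

lemma integral_exceed (c : ℝ) (μ : Measure ℝ) [IsFiniteMeasure μ] :
    ∫ x, exceed c x ∂μ = μ.real (Set.Ioi c) :=
  integral_indicator_one measurableSet_Ioi

lemma variance_exceed (c : ℝ) (μ : Measure ℝ) [IsProbabilityMeasure μ] :
    Var[exceed c; μ] = μ.real (Set.Ioi c) - μ.real (Set.Ioi c) ^ 2 := by
  have hsq : exceed c ^ 2 = exceed c := by
    ext x
    by_cases h : x ∈ Set.Ioi c <;> simp [exceed, h]
  rw [variance_eq_sub (memLp_exceed c μ), hsq, integral_exceed]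

lemma mgf_exceed (c t : ℝ) (μ : Measure ℝ) [IsProbabilityMeasure μ] :
    mgf (exceed c) μ t = 1 + μ.real (Set.Ioi c) * (Real.exp t - 1) := by
  have h : (fun x => Real.exp (t * exceed c x)) =
      fun x => 1 + exceed c x * (Real.exp t - 1) := by
    ext x
    by_cases h : x ∈ Set.Ioi c <;> simp [exceed, h]
  rw [mgf, h, integral_add (integrable_const _)
    (((memLp_exceed c μ).integrable one_le_two).mul_const _), integral_mul_const, integral_exceed]
  simp

section Count

variable {ι : Type*} [Fintype ι]

lemma measurable_sum_exceed (c : ℝ) : Measurable fun z : ι → ℝ => ∑ j, exceed c (z j) :=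
  Finset.measurable_sum _ fun j _ => (measurable_exceed c).comp (measurable_pi_apply j)

lemma sum_exceed_ge_le (c t τ : ℝ) (ht : 0 ≤ t) :
    (gaussianShift (0 : ι → ℝ)).real {z | τ ≤ ∑ j, exceed c (z j)} ≤
      Real.exp (-t * τ + Fintype.card ι * ((gaussianReal 0 1).real (Set.Ioi c) *
        (Real.exp t - 1))) := by
  set p := (gaussianReal 0 1).real (Set.Ioi c)
  have hmgf : mgf (fun z : ι → ℝ => ∑ j, exceed c (z j)) (gaussianShift 0) t =
      (1 + p * (Real.exp t - 1)) ^ Fintype.card ι := by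
    have hind : iIndepFun (fun j (z : ι → ℝ) => exceed c (z j)) (gaussianShift 0) :=
      (iIndepFun_coord_gaussianShift 0).comp (fun _ => exceed c) (fun _ => measurable_exceed c)
    have h := hind.mgf_sum (t := t)
      (fun j => (measurable_exceed c).comp (measurable_pi_apply j)) univ
    have h1 : ∀ j, mgf (fun z : ι → ℝ => exceed c (z j)) (gaussianShift 0) t =
        1 + p * (Real.exp t - 1) := by
      intro j
      rw [← mgf_exceed]
      have hmp := measurePreserving_coord_gaussianShift (0 : ι → ℝ) j
      rw [mgf, mgf, ← show _ = gaussianReal 0 1 from hmp.map_eq,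
        integral_map hmp.measurable.aemeasurable]
      exact (((measurable_exceed c).const_mul t).exp).aestronglyMeasurable
    simp only [h1, prod_const, card_univ] at h
    rw [← h]
    congr 1
    ext z
    simp
  have hint : Integrable (fun z : ι → ℝ => Real.exp (t * ∑ j, exceed c (z j)))
      (gaussianShift 0) := by
    refine Integrable.of_bound
      (((measurable_sum_exceed c).const_mul t).exp).aestronglyMeasurable
      (Real.exp (t * Fintype.card ι)) (.of_forall fun z => ?_)
    rw [Real.norm_of_nonneg (Real.exp_nonneg _)]
    gcongr
    have := sum_le_card_nsmul univ (fun j => exceed c (z j)) 1 fun j _ => exceed_le_one _ _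
    simpa using this
  refine (measure_ge_le_exp_mul_mgf τ ht hint).trans ?_
  rw [hmgf, Real.exp_add, Real.exp_nat_mul]
  have : 0 ≤ p * (Real.exp t - 1) :=
    mul_nonneg measureReal_nonneg (by linarith [Real.add_one_le_exp t])
  gcongr
  linarith [Real.add_one_le_exp (p * (Real.exp t - 1))]

lemma sum_exceed_le_le (v : ι → ℝ) (c r : ℝ) (hr : 0 < r) :
    (gaussianShift v).real
      {z | ∑ j, exceed c (z j) ≤ ∑ j, (gaussianReal (v j) 1).real (Set.Ioi c) - r} ≤
      (∑ j, ((gaussianReal (v j) 1).real (Set.Ioi c) -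
        (gaussianReal (v j) 1).real (Set.Ioi c) ^ 2)) / r ^ 2 := by
  have hcomp : ∀ j, MemLp (fun z : ι → ℝ => exceed c (z j)) 2 (gaussianShift v) := fun j =>
    (memLp_exceed c _).comp_measurePreserving (measurePreserving_coord_gaussianShift v j)
  have hvar : Var[fun z : ι → ℝ => ∑ j, exceed c (z j); gaussianShift v] =
      ∑ j, ((gaussianReal (v j) 1).real (Set.Ioi c) -
        (gaussianReal (v j) 1).real (Set.Ioi c) ^ 2) := by
    have := variance_sum_pi (μ := fun j => gaussianReal (v j) 1) (X := fun _ => exceed c)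
      fun j => memLp_exceed c _
    simp only [variance_exceed] at this
    rw [← this]
    congr 1
    ext z
    simp
  have hmean : ∫ z, ∑ j, exceed c (z j) ∂gaussianShift v =
      ∑ j, (gaussianReal (v j) 1).real (Set.Ioi c) := by
    rw [integral_finsetSum _ fun j _ => (hcomp j).integrable one_le_two]
    refine sum_congr rfl fun j _ => ?_
    have hmp := measurePreserving_coord_gaussianShift v j
    rw [← integral_exceed, ← hmp.map_eq, integral_map hmp.measurable.aemeasurable
      (measurable_exceed c).aestronglyMeasurable]
  have hcheb := meas_ge_le_variance_div_sq (memLp_finsetSum univ fun j _ => hcomp j) hr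
  rw [hvar, hmean] at hcheb
  have hsub : {z : ι → ℝ |
      ∑ j, exceed c (z j) ≤ ∑ j, (gaussianReal (v j) 1).real (Set.Ioi c) - r} ⊆
      {z | r ≤ |∑ j, exceed c (z j) - ∑ j, (gaussianReal (v j) 1).real (Set.Ioi c)|} := by
    intro z hz
    simp only [Set.mem_ofPred_eq] at hz ⊢
    rw [abs_sub_comm]
    exact le_trans (by linarith) (le_abs_self _)
  refine (measureReal_mono hsub).trans (ENNReal.toReal_le_of_le_ofReal ?_ hcheb)
  rw [← hvar]
  exact div_nonneg (variance_nonneg _ _) (sq_nonneg r)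

end Count

lemma exp_neg_sq_div_two_mul {n Λ : ℝ} (hn : 0 < n) (hΛ : 0 ≤ Λ) :
    Real.exp (-√(2 * n * Λ) ^ 2 / (2 * n)) = Real.exp (-Λ) := by
  rw [Real.sq_sqrt (by positivity)]
  congr 1
  field_simp

lemma two_mul_sqrt_le {x y : ℝ} (hy : 0 ≤ y) (h : 4 * x ≤ y ^ 2) : 2 * √x ≤ y := by
  have : √x ≤ y / 2 := Real.sqrt_le_left (by positivity) |>.2 (by nlinarith)
  linarith

lemma exp_neg_log_one_div {δ : ℝ} (hδ : 0 < δ) : Real.exp (-Real.log (1 / δ)) = δ := by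
  rw [Real.exp_neg, Real.exp_log (by positivity)]
  simp

/-- The counting test: reject when the number of coordinates exceeding `a / 2` is large. -/
lemma hasVectorTest_count {ι : Type*} [Fintype ι] {s : ℕ} {a L δ ε κ : ℝ} (ha : 0 ≤ a)
    (hs : 1 ≤ s) (hL : 1 ≤ L) (hLs : L ≤ s) (hδ0 : 0 < δ) (hδ1 : δ ≤ 1)
    (hκ : κ = 8 * (1 + Real.log (1 / δ))) (hεκ : ε * (8 * κ * Real.exp κ) ≤ 1) (hεδ : 8 * ε ≤ δ)
    (haε : Real.exp (-a ^ 2 / 8) ≤ ε)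
    (hda : Fintype.card ι * Real.exp (-a ^ 2 / 8) ≤ ε * s ^ 2 / L) :
    HasVectorTest ι s a (δ * Real.exp (-L)) δ := by
  set p := (gaussianReal 0 1).real (Set.Ioi (a / 2)) with hp
  set d : ℝ := (Fintype.card ι : ℝ)
  have hs0 : (1 : ℝ) ≤ s := by exact_mod_cast hs
  have hL0 : 0 < L := by linarith
  have hε : 0 ≤ ε := (Real.exp_nonneg _).trans haε
  have hp0 : 0 ≤ p := measureReal_nonneg
  have hpa : p ≤ Real.exp (-a ^ 2 / 8) := by
    refine (measureReal_mono fun x hx => le_of_lt (Set.mem_Ioi.1 hx)).trans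
      ((gaussianReal_real_ge_le (m := 0) (c := a / 2) (by linarith)).trans_eq ?_)
    congr 1
    ring
  have hdp : d * p ≤ ε * s ^ 2 / L :=
    (mul_le_mul_of_nonneg_left hpa (Nat.cast_nonneg _)).trans hda
  have hlog : 0 ≤ Real.log (1 / δ) := Real.log_nonneg ((one_le_div hδ0).2 hδ1)
  have hκ0 : 8 ≤ κ := by linarith
  refine ⟨fun z => decide (d * p + s / 4 < ∑ j, exceed (a / 2) (z j)), ?_, ?_, ?_⟩
  · exact measurable_decide_of_measurableSet
      (measurableSet_lt measurable_const (measurable_sum_exceed _))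
  · set t := κ * L / s with ht
    have ht0 : 0 ≤ t := by positivity
    have htκ : t ≤ κ := by
      rw [ht, div_le_iff₀ (by linarith)]
      exact mul_le_mul_of_nonneg_left hLs (by linarith)
    have hsub : {z : ι → ℝ | decide (d * p + s / 4 < ∑ j, exceed (a / 2) (z j)) = true} ⊆
        {z | d * p + s / 4 ≤ ∑ j, exceed (a / 2) (z j)} := by
      intro z hz
      simp only [decide_eq_true_eq, Set.mem_ofPred_eq] at hz ⊢
      exact hz.le
    refine (measureReal_mono hsub).trans ((sum_exceed_ge_le _ t _ ht0).trans ?_)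
    have hexp : Real.exp t - 1 - t ≤ t ^ 2 * Real.exp κ := by
      have h1 : Real.exp t - 1 ≤ t * Real.exp t := by
        have h2 := mul_le_mul_of_nonneg_left (Real.add_one_le_exp (-t)) (Real.exp_nonneg t)
        rw [← Real.exp_add, add_neg_cancel, Real.exp_zero] at h2
        linarith
      have h3 : t * (Real.exp t - 1) ≤ t * (t * Real.exp t) := mul_le_mul_of_nonneg_left h1 ht0
      have h4 : t ^ 2 * Real.exp t ≤ t ^ 2 * Real.exp κ := by gcongr
      linarith [Real.add_one_le_exp t]
    have hmain : d * p * (Real.exp t - 1 - t) ≤ κ * L / 8 := by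
      calc d * p * (Real.exp t - 1 - t) ≤ (ε * s ^ 2 / L) * (t ^ 2 * Real.exp κ) := by
            refine mul_le_mul hdp hexp (by linarith [Real.add_one_le_exp t]) (by positivity)
        _ = ε * (8 * κ * Real.exp κ) * (κ * L / 8) := by
            rw [ht]
            field_simp
        _ ≤ 1 * (κ * L / 8) := by gcongr
        _ = _ := one_mul _
    have hst : t * (s / 4) = κ * L / 4 := by
      rw [ht]
      field_simp
    have hδ : δ * Real.exp (-L) = Real.exp (-Real.log (1 / δ) - L) := by
      rw [sub_eq_add_neg, Real.exp_add, exp_neg_log_one_div hδ0]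
    rw [hδ, Real.exp_le_exp]
    have hLl : Real.log (1 / δ) ≤ L * Real.log (1 / δ) := le_mul_of_one_le_left hlog hL
    have hκL : κ * L = 8 * L + 8 * (L * Real.log (1 / δ)) := by rw [hκ]; ring
    have hexpand : -t * (d * p + s / 4) + d * (p * (Real.exp t - 1)) =
        d * p * (Real.exp t - 1 - t) - t * (s / 4) := by ring
    change -t * (d * p + s / 4) + d * (p * (Real.exp t - 1)) ≤ _
    linarith
  · classical
    intro v S hS hv hv0
    set q : ι → ℝ := fun j => (gaussianReal (v j) 1).real (Set.Ioi (a / 2)) with hq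
    have hq1 : ∀ j, q j ≤ 1 := fun j => measureReal_le_one
    have hq0 : ∀ j, 0 ≤ q j := fun j => measureReal_nonneg
    have hqS : ∀ j ∈ S, 1 - ε ≤ q j := by
      intro j hj
      have h1 : q j = 1 - (gaussianReal (v j) 1).real (Set.Iic (a / 2)) := by
        rw [hq, ← Set.compl_Iic]
        exact probReal_compl_eq_one_sub measurableSet_Iic
      have h2 : (gaussianReal (v j) 1).real (Set.Iic (a / 2)) ≤ _ :=
        gaussianReal_real_le_le (m := v j) (c := a / 2) (by linarith [hv j hj])
      have h3 : Real.exp (-(v j - a / 2) ^ 2 / 2) ≤ Real.exp (-a ^ 2 / 8) := by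
        rw [Real.exp_le_exp]
        nlinarith [hv j hj]
      linarith
    have hqSc : ∀ j ∈ Sᶜ, q j = p := by
      intro j hj
      rw [hq, hp, ← hv0 j (by simpa using hj)]
    have hcardSc : ((Sᶜ.card : ℕ) : ℝ) = d - s := by
      rw [card_compl, Nat.cast_sub (card_le_univ S), hS]
    have hpε : p ≤ ε := hpa.trans haε
    have hmean : d * p + s / 4 ≤ ∑ j, q j - s / 2 := by
      have h1 : (s : ℝ) * (1 - ε) ≤ ∑ j ∈ S, q j := by
        rw [← hS, ← nsmul_eq_mul]
        exact card_nsmul_le_sum _ _ _ hqS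
      rw [← sum_add_sum_compl S q, sum_congr rfl hqSc, sum_const, nsmul_eq_mul, hcardSc]
      nlinarith
    have hvar : ∑ j, (q j - q j ^ 2) ≤ 2 * ε * s ^ 2 := by
      have h1 : ∑ j ∈ S, (q j - q j ^ 2) ≤ s * ε := by
        rw [← hS, ← nsmul_eq_mul]
        refine sum_le_card_nsmul _ _ _ fun j hj => ?_
        nlinarith [hqS j hj, hq1 j, hq0 j]
      have h2 : ∑ j ∈ Sᶜ, (q j - q j ^ 2) ≤ d * p := by
        calc ∑ j ∈ Sᶜ, (q j - q j ^ 2) ≤ ∑ j ∈ Sᶜ, p := by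
              refine sum_le_sum fun j hj => ?_
              rw [hqSc j hj]
              nlinarith
          _ = (d - s) * p := by rw [sum_const, nsmul_eq_mul, hcardSc]
          _ ≤ d * p := by nlinarith
      have h3 : ε * s ^ 2 / L ≤ ε * s ^ 2 := div_le_self (by positivity) hL
      have h4 : (s : ℝ) * ε ≤ s ^ 2 * ε :=
        mul_le_mul_of_nonneg_right (le_self_pow₀ hs0 two_ne_zero) hε
      rw [← sum_add_sum_compl S]
      linarith
    have hsub : {z : ι → ℝ | decide (d * p + s / 4 < ∑ j, exceed (a / 2) (z j)) = false} ⊆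
        {z | ∑ j, exceed (a / 2) (z j) ≤ ∑ j, q j - s / 2} := by
      intro z hz
      simp only [decide_eq_false_iff_not, Set.mem_ofPred_eq, not_lt] at hz ⊢
      linarith
    refine (measureReal_mono hsub).trans
      ((sum_exceed_le_le v _ (s / 2) (by positivity)).trans ?_)
    rw [div_le_iff₀ (by positivity)]
    refine hvar.trans ?_
    nlinarith [sq_nonneg (s : ℝ)]

/-- Sparse detection in a Gaussian vector with exponentially small type I error. -/
theorem exists_hasVectorTest_of_log_le {δ : ℝ} (hδ0 : 0 < δ) (hδ1 : δ ≤ 1) :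
    ∃ K : ℝ, 0 < K ∧ ∀ (ι : Type) [Fintype ι] (s : ℕ) (L a : ℝ), 0 ≤ a → 1 ≤ s →
      s ≤ Fintype.card ι → 1 ≤ L → L ≤ s →
      K * Real.log (1 + Fintype.card ι * L / s ^ 2) ≤ a ^ 2 →
      HasVectorTest ι s a (δ * Real.exp (-L)) δ := by
  set ℓ := Real.log (1 / δ) with hℓ
  have hlog : 0 ≤ ℓ := Real.log_nonneg ((one_le_div hδ0).2 hδ1)
  set κ := 8 * (1 + ℓ) with hκ
  have hκ0 : 0 < κ := by positivity
  set ε := min (1 / (8 * κ * Real.exp κ)) (δ / 8) with hε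
  have hε0 : 0 < ε := lt_min (by positivity) (by positivity)
  have hε1 : ε ≤ 1 := (min_le_right _ _).trans (by linarith)
  have hlogε : 0 ≤ Real.log (1 / ε) := Real.log_nonneg ((one_le_div hε0).2 hε1)
  refine ⟨12 * (1 + ℓ) + 8 * (1 + 2 * Real.log (1 / ε)), by positivity, ?_⟩
  intro ι _ s L a ha hs hsd hL hLs hK
  set d : ℝ := (Fintype.card ι : ℝ)
  have hs0 : (0 : ℝ) < s := by exact_mod_cast hs
  have hd0 : 0 < d := hs0.trans_le (Nat.cast_le.2 hsd)
  set x := d * L / s ^ 2 with hx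
  have hx0 : 0 < x := by positivity
  have hlx : 0 ≤ Real.log (1 + x) := Real.log_nonneg (by linarith)
  rcases le_or_gt x 1 with hx1 | hx1
  · have h1 : 2 * x / 3 ≤ Real.log (1 + x) := by
      refine le_trans ?_ (Real.le_log_one_add_of_nonneg hx0.le)
      gcongr
      linarith
    have h2 : 8 * (L + ℓ) * d ≤ (s * a) ^ 2 := by
      have h3 : 12 * (1 + ℓ) * (2 * x / 3) ≤ a ^ 2 := by nlinarith
      have h4 : (s : ℝ) ^ 2 * x = d * L := by rw [hx]; field_simp
      have h5 : (s : ℝ) ^ 2 * (12 * (1 + ℓ) * (2 * x / 3)) ≤ s ^ 2 * a ^ 2 := by gcongr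
      have h6 : ℓ ≤ ℓ * L := le_mul_of_one_le_right hlog hL
      have h7 : (L + ℓ) * d ≤ (1 + ℓ) * L * d := by
        refine mul_le_mul_of_nonneg_right ?_ hd0.le
        linarith
      have h8 : (s : ℝ) ^ 2 * (12 * (1 + ℓ) * (2 * x / 3)) = 8 * ((1 + ℓ) * L * d) := by
        rw [show (1 + ℓ) * L * d = (1 + ℓ) * (d * L) by ring, ← h4]
        ring
      linarith [mul_pow (s : ℝ) a 2]
    have h := hasVectorTest_scan (s := s) (n := Fintype.card ι) (a := a)
      (t := √(2 * d * (L + ℓ))) {(univ : Finset ι)} (by simp) (fun S _ => ⟨univ, by simp⟩)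
      (Real.sqrt_nonneg _) (two_mul_sqrt_le (by positivity) (by linarith))
    rw [exp_neg_sq_div_two_mul hd0 (by linarith), neg_add, add_comm, Real.exp_add,
      exp_neg_log_one_div hδ0] at h
    refine h.mono (by simp) ?_
    exact mul_le_of_le_one_right hδ0.le (by simp; linarith)
  · have h1 : Real.log x + Real.log (1 / ε) ≤ a ^ 2 / 8 := by
      have h2 : 1 / 2 ≤ Real.log (1 + x) := by
        have := Real.log_two_gt_d9
        exact (by linarith : (1 : ℝ) / 2 ≤ Real.log 2).trans
          (Real.log_le_log (by norm_num) (by linarith))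
      have h3 : Real.log x ≤ Real.log (1 + x) := Real.log_le_log hx0 (by linarith)
      nlinarith
    have hxlog : 0 ≤ Real.log x := Real.log_nonneg hx1.le
    have h2 : Real.exp (-a ^ 2 / 8) ≤ ε / x := by
      have : ε / x = Real.exp (-(Real.log x + Real.log (1 / ε))) := by
        rw [neg_add, Real.exp_add, exp_neg_log_one_div hε0, Real.exp_neg, Real.exp_log hx0]
        field_simp
      rw [this, Real.exp_le_exp]
      linarith
    refine hasVectorTest_count (ε := ε) ha hs hL hLs hδ0 hδ1 hκ ?_ ?_ (h2.trans ?_) ?_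
    · rw [← le_div_iff₀ (by positivity)]
      exact min_le_left _ _
    · linarith [min_le_right (1 / (8 * κ * Real.exp κ)) (δ / 8)]
    · exact div_le_self hε0.le hx1.le
    · refine (mul_le_mul_of_nonneg_left h2 hd0.le).trans_eq ?_
      rw [hx]
      field_simp

/-- There is a test of the null hypothesis against `Theta d₁ d₂ s₁ s₂ μ` with type I and type II
errors at most `α` and `β`. -/
def HasMatrixTest (d₁ d₂ s₁ s₂ : ℕ) (μ α β : ℝ) : Prop :=
  ∃ Δ : (Fin d₁ → Fin d₂ → ℝ) → Bool, Measurable Δ ∧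
    (Pmeas d₁ d₂ 0).real {y | Δ y = true} ≤ α ∧
    ∀ X ∈ Theta d₁ d₂ s₁ s₂ μ, (Pmeas d₁ d₂ X).real {y | Δ y = false} ≤ β

section Matrix

variable {d₁ d₂ s₁ s₂ : ℕ} {μ α β : ℝ}

lemma measurableSet_test_eq {Ω : Type*} [MeasurableSpace Ω] {Δ : Ω → Bool} (h : Measurable Δ)
    (b : Bool) : MeasurableSet {y | Δ y = b} :=
  h (measurableSet_singleton b)

lemma HasMatrixTest.mono {α' β' : ℝ} (h : HasMatrixTest d₁ d₂ s₁ s₂ μ α β) (hα : α ≤ α')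
    (hβ : β ≤ β') : HasMatrixTest d₁ d₂ s₁ s₂ μ α' β' := by
  obtain ⟨Δ, hm, h0, h1⟩ := h
  exact ⟨Δ, hm, h0.trans hα, fun X hX => (h1 X hX).trans hβ⟩

lemma HasMatrixTest.swap (h : HasMatrixTest d₁ d₂ s₁ s₂ μ α β) :
    HasMatrixTest d₂ d₁ s₂ s₁ μ α β := by
  obtain ⟨Δ, hm, h0, h1⟩ := h
  have hswap : Measurable fun (Y : Fin d₂ → Fin d₁ → ℝ) i j => Y j i := by fun_prop
  have key : ∀ (X : Fin d₂ → Fin d₁ → ℝ) (b : Bool),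
      (Pmeas d₂ d₁ X).real {Y | Δ (fun i j => Y j i) = b} =
        (Pmeas d₁ d₂ fun i j => X j i).real {y | Δ y = b} := by
    intro X b
    rw [← Pmeas_map_swap d₂ d₁ X, map_measureReal_apply hswap (measurableSet_test_eq hm b)]
    rfl
  refine ⟨fun Y => Δ fun i j => Y j i, hm.comp hswap, ?_, ?_⟩
  · rw [key]
    exact h0
  · rintro X ⟨S₁, S₂, h₁, h₂, hge, hz⟩
    rw [key]
    exact h1 _ ⟨S₂, S₁, h₂, h₁, fun i j hi hj => hge j i hj hi,
      fun i j hij => hz j i fun h => hij h.symm⟩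

lemma HasMatrixTest.risk_le (h : HasMatrixTest d₁ d₂ s₁ s₂ μ α β) (hβ : 0 ≤ β) :
    ∃ Δ : (Fin d₁ → Fin d₂ → ℝ) → Bool, Measurable Δ ∧ risk d₁ d₂ s₁ s₂ μ Δ ≤ α + β := by
  obtain ⟨Δ, hm, h0, h1⟩ := h
  exact ⟨Δ, hm, add_le_add h0 (Real.iSup_le (fun X => Real.iSup_le (h1 X) hβ) hβ)⟩

/-- The column sums over the rows in `A`, normalised to have unit variance. -/
noncomputable def columnScore (A : Finset (Fin d₁)) (Y : Fin d₁ → Fin d₂ → ℝ) : Fin d₂ → ℝ :=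
  fun j => (∑ i ∈ A, Y i j) / √(A.card : ℝ)

lemma measurable_columnScore (A : Finset (Fin d₁)) :
    Measurable (columnScore (d₂ := d₂) A) := by
  unfold columnScore
  fun_prop

lemma Pmeas_map_columnScore {A : Finset (Fin d₁)} (hA : 0 < A.card)
    (X : Fin d₁ → Fin d₂ → ℝ) :
    (Pmeas d₁ d₂ X).map (columnScore A) = gaussianShift (columnScore A X) := by
  have hcomp : columnScore (d₂ := d₂) A =
      (fun (z : Fin d₂ → Fin d₁ → ℝ) j => (∑ i ∈ A, z j i) / √(A.card : ℝ)) ∘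
        fun Y j i => Y i j := rfl
  have hlaw : ∀ j, (gaussianShift fun i => X i j).map
      (fun z => (∑ i ∈ A, z i) / √(A.card : ℝ)) = gaussianReal (columnScore A X j) 1 :=
    fun j => gaussianShift_map_sum_div_sqrt _ hA
  rw [hcomp, ← Measure.map_map (by fun_prop) (by fun_prop), Pmeas_map_swap]
  have hpi := Measure.pi_map_pi (μ := fun j => gaussianShift fun i => X i j)
    (f := fun (_ : Fin d₂) (z : Fin d₁ → ℝ) => (∑ i ∈ A, z i) / √(A.card : ℝ))
    (hμ := fun j => by rw [hlaw]; infer_instance) fun j => by fun_prop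
  refine hpi.trans ?_
  simp only [hlaw]
  rfl

/-- Applying a vector test to the column scores of all members of a family of row sets. -/
lemma HasVectorTest.hasMatrixTest {m : ℕ} (hm : 0 < m)
    (𝒜 : Finset (Finset (Fin d₁))) (hcard : ∀ A ∈ 𝒜, A.card = m)
    (hcover : ∀ S : Finset (Fin d₁), S.card = s₁ → ∃ A ∈ 𝒜, S ⊆ A)
    (h : HasVectorTest (Fin d₂) s₂ (s₁ * μ / √(m : ℝ)) α β) :
    HasMatrixTest d₁ d₂ s₁ s₂ μ (𝒜.card * α) β := by
  classical
  obtain ⟨φ, hφ, h0, h1⟩ := h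
  have key : ∀ A ∈ 𝒜, ∀ (X : Fin d₁ → Fin d₂ → ℝ) (b : Bool),
      (Pmeas d₁ d₂ X).real {Y | φ (columnScore A Y) = b} =
        (gaussianShift (columnScore A X)).real {z | φ z = b} := by
    intro A hA X b
    rw [← Pmeas_map_columnScore (by rw [hcard A hA]; exact hm),
      map_measureReal_apply (measurable_columnScore A) (measurableSet_test_eq hφ b)]
    rfl
  refine ⟨fun Y => decide (∃ A ∈ 𝒜, φ (columnScore A Y) = true), ?_, ?_, ?_⟩
  · refine measurable_decide_of_measurableSet ?_
    have : {Y : Fin d₁ → Fin d₂ → ℝ | ∃ A ∈ 𝒜, φ (columnScore A Y) = true} =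
        ⋃ A ∈ 𝒜, {Y | φ (columnScore A Y) = true} := by
      ext; simp
    rw [this]
    exact Finset.measurableSet_biUnion _ fun A _ =>
      measurableSet_test_eq (hφ.comp (measurable_columnScore A)) true
  · have hsub : {Y : Fin d₁ → Fin d₂ → ℝ |
        decide (∃ A ∈ 𝒜, φ (columnScore A Y) = true) = true} ⊆
        ⋃ A ∈ 𝒜, {Y | φ (columnScore A Y) = true} := by
      intro Y hY
      simpa using hY
    refine (measureReal_mono hsub (measure_ne_top _ _)).trans
      ((measureReal_biUnion_finset_le _ _).trans ?_)
    rw [← nsmul_eq_mul]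
    refine sum_le_card_nsmul _ _ _ fun A hA => ?_
    rw [key A hA, show columnScore A (0 : Fin d₁ → Fin d₂ → ℝ) = 0 by ext; simp [columnScore]]
    exact h0
  · rintro X ⟨S₁, S₂, hS₁, hS₂, hge, hz⟩
    obtain ⟨A, hA, hSA⟩ := hcover S₁ hS₁
    have hsub : {Y : Fin d₁ → Fin d₂ → ℝ |
        decide (∃ A ∈ 𝒜, φ (columnScore A Y) = true) = false} ⊆
        {Y | φ (columnScore A Y) = false} := by
      intro Y hY
      simp only [decide_eq_false_iff_not, Set.mem_ofPred_eq, not_exists, not_and,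
        Bool.not_eq_true] at hY ⊢
      exact hY A hA
    refine (measureReal_mono hsub).trans ?_
    rw [key A hA]
    refine h1 _ S₂ hS₂ (fun j hj => ?_) fun j hj => ?_
    · rw [columnScore, hcard A hA]
      gcongr
      rw [← hS₁, ← nsmul_eq_mul]
      refine (card_nsmul_le_sum S₁ _ _ fun i hi => hge i j hi hj).trans
        (sum_le_sum_of_subset_of_nonneg hSA fun i _ hi => ?_)
      rw [hz i j fun h => hi h.1]
    · rw [columnScore, sum_eq_zero fun i _ => hz i j fun h => hj h.2, zero_div]

end Matrix

lemma log_exp_one_mul_choose {d s : ℕ} (hsd : s ≤ d) :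
    Real.log (Real.exp 1 * (d.choose s : ℝ)) = 1 + Real.log (d.choose s) := by
  have : (0 : ℝ) < d.choose s := Nat.cast_pos.2 (Nat.choose_pos hsd)
  rw [Real.log_mul (Real.exp_ne_zero 1) this.ne', Real.log_exp]

lemma one_le_log_exp_one_mul_choose {d s : ℕ} (hsd : s ≤ d) :
    1 ≤ Real.log (Real.exp 1 * (d.choose s : ℝ)) := by
  rw [log_exp_one_mul_choose hsd]
  have : (1 : ℝ) ≤ d.choose s := Nat.one_le_cast.2 (Nat.choose_pos hsd)
  linarith [Real.log_nonneg this]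

lemma choose_mul_exp_neg_log {d s : ℕ} (hsd : s ≤ d) :
    (d.choose s : ℝ) * Real.exp (-Real.log (Real.exp 1 * (d.choose s : ℝ))) = Real.exp (-1) := by
  have : (0 : ℝ) < d.choose s := Nat.cast_pos.2 (Nat.choose_pos hsd)
  rw [log_exp_one_mul_choose hsd, neg_add, Real.exp_add, Real.exp_neg (Real.log _),
    Real.exp_log this]
  field_simp

lemma log_exp_one_mul_choose_le {d s : ℕ} (hs : 1 ≤ s) (hsd : s ≤ d) :
    Real.log (Real.exp 1 * (d.choose s : ℝ)) ≤ 6 * (s * Real.log (1 + d / s)) := by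
  have hs0 : (1 : ℝ) ≤ s := by exact_mod_cast hs
  have hds : (s : ℝ) ≤ d := by exact_mod_cast hsd
  have hr : 1 ≤ (d : ℝ) / s := (one_le_div (by linarith)).2 hds
  have hc : (0 : ℝ) < d.choose s := Nat.cast_pos.2 (Nat.choose_pos hsd)
  have hchoose : (d.choose s : ℝ) ≤ (d / s) ^ s * Real.exp s := by
    calc (d.choose s : ℝ) ≤ d ^ s / s.factorial := Nat.choose_le_pow_div s d
      _ = (d / s : ℝ) ^ s * ((s : ℝ) ^ s / s.factorial) := by
          rw [div_pow]
          field_simp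
      _ ≤ _ := by
          gcongr
          exact Real.pow_div_factorial_le_exp _ (by linarith) s
  have hlog : Real.log (d.choose s) ≤ s * Real.log (d / s) + s := by
    refine (Real.log_le_log hc hchoose).trans_eq ?_
    rw [Real.log_mul (by positivity) (Real.exp_ne_zero _), Real.log_pow, Real.log_exp]
  have h1 : Real.log (d / s) ≤ Real.log (1 + d / s) :=
    Real.log_le_log (by linarith) (by linarith)
  have h2 : 1 / 2 ≤ Real.log (1 + d / s) := by
    have := Real.log_two_gt_d9
    exact (by linarith : (1 : ℝ) / 2 ≤ Real.log 2).trans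
      (Real.log_le_log (by norm_num) (by linarith))
  rw [log_exp_one_mul_choose hsd]
  have h3 : 0 ≤ s * (Real.log (1 + d / s) - Real.log (d / s)) :=
    mul_nonneg (by linarith) (by linarith)
  have h4 : 0 ≤ s * (Real.log (1 + d / s) - 1 / 2) := mul_nonneg (by linarith) (by linarith)
  nlinarith

lemma exists_superset_powersetCard {ι : Type*} [Fintype ι] {s : ℕ} (S : Finset ι)
    (hS : S.card = s) : ∃ A ∈ powersetCard s (univ : Finset ι), S ⊆ A :=
  ⟨S, mem_powersetCard.2 ⟨subset_univ S, hS⟩, Subset.rfl⟩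

lemma sq_mul_div_sqrt (x y : ℝ) {m : ℝ} (hm : 0 ≤ m) :
    (x * y / √m) ^ 2 = x ^ 2 * y ^ 2 / m := by
  rw [div_pow, mul_pow, Real.sq_sqrt hm]

/-- The test attaining the rate `phi`, based on the sums over all rows. -/
lemma exists_hasMatrixTest_of_phi_le {δ : ℝ} (hδ0 : 0 < δ) (hδ1 : δ ≤ 1) :
    ∃ K : ℝ, 0 < K ∧ ∀ (d₁ d₂ s₁ s₂ : ℕ) (μ : ℝ), 0 < μ → 1 ≤ s₁ → s₁ ≤ d₁ → 1 ≤ s₂ → s₂ ≤ d₂ →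
      K * phi s₁ s₂ d₁ d₂ ≤ μ ^ 2 → HasMatrixTest d₁ d₂ s₁ s₂ μ δ δ := by
  obtain ⟨K, hK0, hK⟩ := exists_hasVectorTest_of_log_le hδ0 hδ1
  refine ⟨K, hK0, fun d₁ d₂ s₁ s₂ μ hμ hs₁ hsd₁ hs₂ hsd₂ h => ?_⟩
  have hd₁ : (0 : ℝ) < d₁ := by exact_mod_cast hs₁.trans hsd₁
  have hs₁0 : (0 : ℝ) < s₁ := by exact_mod_cast hs₁
  have hv := hK (Fin d₂) s₂ 1 (s₁ * μ / √(d₁ : ℝ)) (by positivity) hs₂ (by simpa) le_rfl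
    (by exact_mod_cast hs₂) (by
      rw [sq_mul_div_sqrt _ _ hd₁.le, Fintype.card_fin, mul_one, le_div_iff₀ hd₁]
      rw [phi, div_mul_eq_mul_div, mul_div_assoc', div_le_iff₀ (by positivity)] at h
      linarith)
  refine (hv.hasMatrixTest (hs₁.trans hsd₁) {univ} (by simp)
    fun S _ => ⟨univ, by simp⟩).mono ?_ le_rfl
  rw [card_singleton, Nat.cast_one, one_mul]
  exact mul_le_of_le_one_right hδ0.le (by simp)

/-- The test scanning over the sets of `s₁` rows. -/
lemma exists_hasMatrixTest_of_psi_le {δ : ℝ} (hδ0 : 0 < δ) (hδ1 : δ ≤ 1) :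
    ∃ K : ℝ, 0 < K ∧ ∀ (d₁ d₂ s₁ s₂ : ℕ) (μ : ℝ), 0 < μ → 1 ≤ s₁ → s₁ ≤ d₁ → 1 ≤ s₂ → s₂ ≤ d₂ →
      Real.log (Real.exp 1 * (d₁.choose s₁ : ℝ)) ≤ s₂ →
      K * psi s₁ s₂ d₁ d₂ ≤ μ ^ 2 → HasMatrixTest d₁ d₂ s₁ s₂ μ δ δ := by
  obtain ⟨K, hK0, hK⟩ := exists_hasVectorTest_of_log_le hδ0 hδ1
  refine ⟨K, hK0, fun d₁ d₂ s₁ s₂ μ hμ hs₁ hsd₁ hs₂ hsd₂ hL h => ?_⟩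
  have hs₁0 : (0 : ℝ) < s₁ := by exact_mod_cast hs₁
  have hv := hK (Fin d₂) s₂ _ (s₁ * μ / √(s₁ : ℝ)) (by positivity) hs₂ (by simpa)
    (one_le_log_exp_one_mul_choose hsd₁) hL (by
      rw [sq_mul_div_sqrt _ _ hs₁0.le, Fintype.card_fin, ← div_mul_eq_mul_div, le_div_iff₀ hs₁0]
      rw [psi, div_mul_eq_mul_div, mul_div_assoc', div_le_iff₀ hs₁0] at h
      nlinarith)
  refine (hv.hasMatrixTest hs₁ (powersetCard s₁ univ)
    (fun A hA => (mem_powersetCard.1 hA).2) exists_superset_powersetCard).mono ?_ le_rfl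
  rw [card_powersetCard, card_univ, Fintype.card_fin, mul_left_comm,
    choose_mul_exp_neg_log hsd₁]
  exact mul_le_of_le_one_right hδ0.le (by simp)

/-- The test scanning over all submatrices of size `s₁ × s₂`. -/
lemma hasMatrixTest_scan {δ μ : ℝ} (hδ0 : 0 < δ) (hδ1 : δ ≤ 1) {d₁ d₂ s₁ s₂ : ℕ} (hμ : 0 < μ)
    (hs₁ : 1 ≤ s₁) (hsd₁ : s₁ ≤ d₁) (hs₂ : 1 ≤ s₂) (hsd₂ : s₂ ≤ d₂)
    (h : 8 * (Real.log (Real.exp 1 * (d₁.choose s₁ : ℝ)) +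
      Real.log (Real.exp 1 * (d₂.choose s₂ : ℝ)) + Real.log (1 / δ)) ≤ s₁ * s₂ * μ ^ 2) :
    HasMatrixTest d₁ d₂ s₁ s₂ μ δ δ := by
  have hs₁0 : (0 : ℝ) < s₁ := by exact_mod_cast hs₁
  have hs₂0 : (0 : ℝ) < s₂ := by exact_mod_cast hs₂
  have hℓ : 0 ≤ Real.log (1 / δ) := Real.log_nonneg ((one_le_div hδ0).2 hδ1)
  have hL₁ := one_le_log_exp_one_mul_choose hsd₁
  have hL₂ := one_le_log_exp_one_mul_choose hsd₂
  have hC₁ := choose_mul_exp_neg_log hsd₁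
  have hC₂ := choose_mul_exp_neg_log hsd₂
  set L₁ := Real.log (Real.exp 1 * (d₁.choose s₁ : ℝ))
  set L₂ := Real.log (Real.exp 1 * (d₂.choose s₂ : ℝ))
  have hv := hasVectorTest_scan (ι := Fin d₂) (s := s₂) (n := s₂) (a := s₁ * μ / √(s₁ : ℝ))
    (t := √(2 * s₂ * (L₁ + L₂ + Real.log (1 / δ)))) (powersetCard s₂ univ)
    (fun B hB => (mem_powersetCard.1 hB).2) exists_superset_powersetCard
    (Real.sqrt_nonneg _) (two_mul_sqrt_le (by positivity) (by
      rw [mul_pow, sq_mul_div_sqrt _ _ hs₁0.le]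
      have h1 : (s₂ : ℝ) ^ 2 * (s₁ ^ 2 * μ ^ 2 / s₁) = s₂ * (s₁ * s₂ * μ ^ 2) := by
        field_simp
      rw [h1]
      nlinarith))
  rw [exp_neg_sq_div_two_mul hs₂0 (by linarith), neg_add, neg_add, Real.exp_add, Real.exp_add,
    exp_neg_log_one_div hδ0, card_powersetCard, card_univ, Fintype.card_fin] at hv
  have he : Real.exp (-1) ≤ 1 := by simp
  refine (hv.hasMatrixTest hs₁ (powersetCard s₁ univ)
    (fun A hA => (mem_powersetCard.1 hA).2) exists_superset_powersetCard).mono ?_ ?_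
  · rw [card_powersetCard, card_univ, Fintype.card_fin]
    calc (d₁.choose s₁ : ℝ) * (d₂.choose s₂ * (Real.exp (-L₁) * Real.exp (-L₂) * δ)) =
        (d₁.choose s₁ * Real.exp (-L₁)) * (d₂.choose s₂ * Real.exp (-L₂)) * δ := by ring
      _ = Real.exp (-1) * Real.exp (-1) * δ := by rw [hC₁, hC₂]
      _ ≤ δ := mul_le_of_le_one_left hδ0.le (mul_le_one₀ he (Real.exp_nonneg _) he)
  · refine mul_le_of_le_one_left hδ0.le (mul_le_one₀ ?_ (Real.exp_nonneg _) ?_) <;>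
      simp <;> linarith

lemma psi_pos {s₁ s₂ d₁ d₂ : ℕ} (hs₁ : 0 < s₁) (hsd₁ : s₁ ≤ d₁) (hs₂ : 0 < s₂) (hd₂ : 0 < d₂) :
    0 < psi s₁ s₂ d₁ d₂ := by
  have := one_le_log_exp_one_mul_choose hsd₁
  refine mul_pos (by positivity) (Real.log_pos (lt_add_of_pos_right _ ?_))
  exact mul_pos (by positivity) (by linarith)

lemma phi_pos {s₁ s₂ d₁ d₂ : ℕ} (hs₁ : 0 < s₁) (hd₁ : 0 < d₁) (hs₂ : 0 < s₂) (hd₂ : 0 < d₂) :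
    0 < phi s₁ s₂ d₁ d₂ :=
  mul_pos (by positivity) (Real.log_pos (lt_add_of_pos_right _ (by positivity)))

lemma mul_log_le_mul_psi {s₁ s₂ d₁ d₂ : ℕ} (hs₁ : 0 < s₁) (hs₂ : 0 < s₂)
    (h : (s₂ : ℝ) ≤ Real.log (Real.exp 1 * (d₁.choose s₁ : ℝ))) :
    s₂ * Real.log (1 + d₂ / s₂) ≤ s₁ * s₂ * psi s₁ s₂ d₁ d₂ := by
  have h1 : (s₁ : ℝ) * s₂ * psi s₁ s₂ d₁ d₂ = s₂ * Real.log (1 + ((d₂ : ℝ) / (s₂ : ℝ) ^ 2) *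
      Real.log (Real.exp 1 * (d₁.choose s₁ : ℝ))) := by
    rw [psi]
    field_simp
  rw [h1]
  gcongr
  calc (d₂ : ℝ) / s₂ = d₂ / s₂ ^ 2 * s₂ := by field_simp
    _ ≤ _ := by gcongr

theorem exists_hasMatrixTest_of_rateR_le {δ : ℝ} (hδ0 : 0 < δ) (hδ1 : δ ≤ 1) :
    ∃ C : ℝ, 0 < C ∧ ∀ (d₁ d₂ s₁ s₂ : ℕ) (μ : ℝ), 0 < μ → 1 ≤ s₁ → s₁ ≤ d₁ → 1 ≤ s₂ → s₂ ≤ d₂ →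
      C * rateR s₁ s₂ d₁ d₂ ≤ μ ^ 2 → HasMatrixTest d₁ d₂ s₁ s₂ μ δ δ := by
  obtain ⟨K₁, hK₁, hphi⟩ := exists_hasMatrixTest_of_phi_le hδ0 hδ1
  obtain ⟨K₂, hK₂, hpsi⟩ := exists_hasMatrixTest_of_psi_le hδ0 hδ1
  set ℓ := Real.log (1 / δ)
  have hℓ : 0 ≤ ℓ := Real.log_nonneg ((one_le_div hδ0).2 hδ1)
  refine ⟨K₁ + K₂ + 48 * (1 + ℓ), by positivity,
    fun d₁ d₂ s₁ s₂ μ hμ hs₁ hsd₁ hs₂ hsd₂ h => ?_⟩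
  have hd₁ := hs₁.trans hsd₁
  have hd₂ := hs₂.trans hsd₂
  have hφ₁₂ := (phi_pos hs₁ hd₁ hs₂ hd₂).le
  have hφ₂₁ := (phi_pos hs₂ hd₂ hs₁ hd₁).le
  have hψ₁₂ := (psi_pos hs₁ hsd₁ hs₂ hd₂).le
  have hψ₂₁ := (psi_pos hs₂ hsd₂ hs₁ hd₁).le
  rcases min_choice (psi s₁ s₂ d₁ d₂ + psi s₂ s₁ d₂ d₁)
    (min (phi s₁ s₂ d₁ d₂) (phi s₂ s₁ d₂ d₁)) with h1 | h1 <;> rw [rateR, h1] at h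
  · rcases le_or_gt (Real.log (Real.exp 1 * (d₁.choose s₁ : ℝ))) s₂ with hL₁ | hL₁
    · exact hpsi d₁ d₂ s₁ s₂ μ hμ hs₁ hsd₁ hs₂ hsd₂ hL₁ (le_trans (by gcongr <;> linarith) h)
    rcases le_or_gt (Real.log (Real.exp 1 * (d₂.choose s₂ : ℝ))) s₁ with hL₂ | hL₂
    · exact (hpsi d₂ d₁ s₂ s₁ μ hμ hs₂ hsd₂ hs₁ hsd₁ hL₂
        (le_trans (by gcongr <;> linarith) h)).swap
    refine hasMatrixTest_scan hδ0 hδ1 hμ hs₁ hsd₁ hs₂ hsd₂ ?_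
    have h₁ := one_le_log_exp_one_mul_choose hsd₁
    have h₂ := one_le_log_exp_one_mul_choose hsd₂
    have hle₁ := log_exp_one_mul_choose_le hs₁ hsd₁
    have hle₂ := log_exp_one_mul_choose_le hs₂ hsd₂
    have hψ₁ := mul_log_le_mul_psi (d₂ := d₂) hs₁ hs₂ hL₁.le
    have hψ₂ := mul_log_le_mul_psi (d₂ := d₁) hs₂ hs₁ hL₂.le
    set L₁ := Real.log (Real.exp 1 * (d₁.choose s₁ : ℝ))
    set L₂ := Real.log (Real.exp 1 * (d₂.choose s₂ : ℝ))
    set ψ := psi s₁ s₂ d₁ d₂ + psi s₂ s₁ d₂ d₁ with hψ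
    have hss : (0 : ℝ) < s₁ * s₂ := by
      have : 0 < s₁ * s₂ := Nat.mul_pos hs₁ hs₂
      exact_mod_cast this
    calc 8 * (L₁ + L₂ + ℓ) ≤ 8 * (1 + ℓ) * (L₁ + L₂) := by nlinarith
      _ ≤ 8 * (1 + ℓ) * (6 * (s₁ * s₂ * ψ)) := by
          refine mul_le_mul_of_nonneg_left ?_ (by positivity)
          rw [hψ]
          linarith
      _ = s₁ * s₂ * (48 * (1 + ℓ) * ψ) := by ring
      _ ≤ s₁ * s₂ * μ ^ 2 := by
          refine mul_le_mul_of_nonneg_left (le_trans ?_ h) hss.le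
          gcongr
          linarith
  · rcases min_choice (phi s₁ s₂ d₁ d₂) (phi s₂ s₁ d₂ d₁) with h2 | h2 <;> rw [h2] at h
    · refine hphi d₁ d₂ s₁ s₂ μ hμ hs₁ hsd₁ hs₂ hsd₂ (le_trans ?_ h)
      gcongr
      linarith
    · refine (hphi d₂ d₁ s₂ s₁ μ hμ hs₂ hsd₂ hs₁ hsd₁ (le_trans ?_ h)).swap
      gcongr
      linarith

lemma rateR_pos {s₁ s₂ d₁ d₂ : ℕ} (hs₁ : 0 < s₁) (hsd₁ : s₁ ≤ d₁) (hs₂ : 0 < s₂)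
    (hsd₂ : s₂ ≤ d₂) : 0 < rateR s₁ s₂ d₁ d₂ :=
  have hd₁ := hs₁.trans_le hsd₁
  have hd₂ := hs₂.trans_le hsd₂
  lt_min (add_pos (psi_pos hs₁ hsd₁ hs₂ hd₂) (psi_pos hs₂ hsd₂ hs₁ hd₁))
    (lt_min (phi_pos hs₁ hd₁ hs₂ hd₂) (phi_pos hs₂ hd₂ hs₁ hd₁))

end

/-- Upper bound on the minimax separation rate (Theorem 1, part 2). -/
theorem upper_bound (η : ℝ) (hη0 : 0 < η) (hη1 : η < 1) :
    ∃ C' : ℝ, 0 < C' ∧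
      ∀ (d₁ d₂ s₁ s₂ : ℕ), 0 < d₁ → 0 < d₂ →
        1 ≤ s₁ → s₁ ≤ d₁ → 1 ≤ s₂ → s₂ ≤ d₂ →
        (∀ μ : ℝ, 0 < μ → C' * rateR s₁ s₂ d₁ d₂ ≤ μ ^ 2 →
          ∃ Δ : (Fin d₁ → Fin d₂ → ℝ) → Bool, Measurable Δ ∧
            risk d₁ d₂ s₁ s₂ μ Δ ≤ η) ∧
        (muStar η d₁ d₂ s₁ s₂) ^ 2 ≤ C' * rateR s₁ s₂ d₁ d₂ := by
  obtain ⟨C, hC, hT⟩ := exists_hasMatrixTest_of_rateR_le (δ := η / 3) (by linarith) (by linarith)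
  refine ⟨C, hC, fun d₁ d₂ s₁ s₂ _ _ hs₁ hsd₁ hs₂ hsd₂ => ?_⟩
  have hrisk : ∀ μ : ℝ, 0 < μ → C * rateR s₁ s₂ d₁ d₂ ≤ μ ^ 2 →
      ∃ Δ : (Fin d₁ → Fin d₂ → ℝ) → Bool, Measurable Δ ∧ risk d₁ d₂ s₁ s₂ μ Δ < η := by
    intro μ hμ h
    obtain ⟨Δ, hm, hΔ⟩ := (hT d₁ d₂ s₁ s₂ μ hμ hs₁ hsd₁ hs₂ hsd₂ h).risk_le (by linarith)
    exact ⟨Δ, hm, by linarith⟩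
  refine ⟨fun μ hμ h => ?_, ?_⟩
  · obtain ⟨Δ, hm, hΔ⟩ := hrisk μ hμ h
    exact ⟨Δ, hm, hΔ.le⟩
  · have hpos : 0 < C * rateR s₁ s₂ d₁ d₂ := mul_pos hC (rateR_pos hs₁ hsd₁ hs₂ hsd₂)
    have hsq : √(C * rateR s₁ s₂ d₁ d₂) ^ 2 = C * rateR s₁ s₂ d₁ d₂ := Real.sq_sqrt hpos.le
    have hle : muStar η d₁ d₂ s₁ s₂ ≤ √(C * rateR s₁ s₂ d₁ d₂) :=
      csInf_le ⟨0, fun μ hμ => hμ.1.le⟩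
        ⟨Real.sqrt_pos.2 hpos, hrisk _ (Real.sqrt_pos.2 hpos) hsq.ge⟩
    have h0 : 0 ≤ muStar η d₁ d₂ s₁ s₂ := Real.sInf_nonneg fun μ hμ => hμ.1.le
    calc muStar η d₁ d₂ s₁ s₂ ^ 2 ≤ √(C * rateR s₁ s₂ d₁ d₂) ^ 2 := by gcongr
      _ = C * rateR s₁ s₂ d₁ d₂ := hsq
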